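/- Let 1 < p < ∞ and let f : ℝⁿ → ℝ be continuously differentiable with ∫_{ℝⁿ} |∇f(x)|ᵖ dx < ∞. Define m(f)(x,r) = O(f,B(x,r)) for (x,r) ∈ ℝⁿ × (0,∞), and let ν_p be the measure on ℝⁿ × (0,∞) given by dν_p = dx dr / r^{p+1}. Then there is a constant C = C(n,p) such that sup_{λ>0} λᵖ ν_p({(x,r) : m(f)(x,r) > λ}) ≤ C · ∫_{ℝⁿ} |∇f|ᵖ dx, i.e. ‖m(f)‖_{L^{p,∞}(ℝ^{n+1}₊, ν_p)} ≲ ‖∇f‖_{Lᵖ(ℝⁿ)}. -/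

import Mathlib

open MeasureTheory Set
open scoped ENNReal Classical

noncomputable section

/-- The open Euclidean ball of center `x` and radius `r` in `ℝⁿ`. -/
def eBall {n : ℕ} (x : Fin n → ℝ) (r : ℝ) : Set (Fin n → ℝ) :=
  {y | ∑ i, (y i - x i) ^ 2 < r ^ 2}

/-- The mean oscillation `O(f,E) = ⨍_E |f - ⨍_E f|` (w.r.t. Lebesgue measure). -/
def osc {n : ℕ} (f : (Fin n → ℝ) → ℝ) (E : Set (Fin n → ℝ)) : ℝ :=
  ⨍ x in E, |f x - ⨍ y in E, f y|

/-- The measure `ν_p` on `ℝⁿ × (0,∞)` given by `dν_p = dx dr / r^{p+1}`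
(realized on `ℝⁿ × ℝ`; only sets of points with positive last coordinate are used). -/
def nuP (n : ℕ) (p : ℝ) : Measure ((Fin n → ℝ) × ℝ) :=
  (volume.prod volume).withDensity fun z => ENNReal.ofReal (z.2 ^ (-(p + 1)))

/-- The increment of a `C¹` function is controlled by the integral of its derivative
along the segment. -/
lemma enorm_sub_le_lintegral_fderiv {E : Type*} [NormedAddCommGroup E] [NormedSpace ℝ E]
    {f : E → ℝ} (hf : ContDiff ℝ 1 f) (a b : E) :
    ‖f b - f a‖ₑ ≤ ‖b - a‖ₑ *
      ∫⁻ t in Icc (0 : ℝ) 1, ‖fderiv ℝ f (a + t • (b - a))‖ₑ := by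
  have hd : ∀ t ∈ uIcc (0 : ℝ) 1, HasDerivAt (fun t : ℝ => f (a + t • (b - a)))
      (fderiv ℝ f (a + t • (b - a)) (b - a)) t := by
    intro t _
    have h1 : HasDerivAt (fun t : ℝ => a + t • (b - a)) (b - a) t := by
      simpa using ((hasDerivAt_id t).smul_const (b - a)).const_add a
    exact ((hf.differentiable one_ne_zero) _).hasFDerivAt.comp_hasDerivAt t h1
  have hc : Continuous fun t : ℝ => fderiv ℝ f (a + t • (b - a)) :=
    (hf.continuous_fderiv one_ne_zero).comp (by fun_prop)
  have hi := intervalIntegral.integral_eq_sub_of_hasDerivAt hd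
    ((hc.clm_apply continuous_const).intervalIntegrable 0 1)
  simp only [one_smul, zero_smul, add_zero, add_sub_cancel] at hi
  rw [← hi, intervalIntegral.integral_of_le zero_le_one, ← integral_Icc_eq_integral_Ioc,
    ← lintegral_const_mul _ hc.enorm.measurable]
  refine (enorm_integral_le_lintegral_enorm _).trans (lintegral_mono fun t => ?_)
  rw [mul_comm]
  exact ContinuousLinearMap.le_opENorm _ _

lemma isOpen_eBall {n : ℕ} (x : Fin n → ℝ) (r : ℝ) : IsOpen (eBall x r) :=
  isOpen_lt (f := fun y : Fin n → ℝ => ∑ i, (y i - x i) ^ 2) (by fun_prop) continuous_const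

lemma abs_lt_one_of_mem_eBall {n : ℕ} {u : Fin n → ℝ} (hu : u ∈ eBall 0 1) (i : Fin n) :
    |u i| < 1 := by
  have h : ∑ j, (u j) ^ 2 < 1 := by simpa [eBall] using hu
  have := Finset.single_le_sum (f := fun j => (u j) ^ 2) (fun j _ => sq_nonneg _)
    (Finset.mem_univ i)
  exact (sq_lt_one_iff_abs_lt_one _).1 (this.trans_lt h)

lemma norm_le_one_of_mem_eBall {n : ℕ} {u : Fin n → ℝ} (hu : u ∈ eBall 0 1) : ‖u‖ ≤ 1 :=
  (pi_norm_le_iff_of_nonneg zero_le_one).2 fun i => (abs_lt_one_of_mem_eBall hu i).le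

lemma volume_eBall_ne_zero {n : ℕ} : volume (eBall (0 : Fin n → ℝ) 1) ≠ 0 :=
  (isOpen_eBall _ _).measure_ne_zero _ ⟨0, by simp [eBall]⟩

lemma volume_eBall_ne_top {n : ℕ} : volume (eBall (0 : Fin n → ℝ) 1) ≠ ∞ := by
  refine ((measure_mono fun u hu => ?_).trans_lt
    (measure_closedBall_lt_top (x := (0 : Fin n → ℝ)) (r := 1))).ne
  simpa using norm_le_one_of_mem_eBall hu

lemma setIntegral_eBall {n : ℕ} (φ : (Fin n → ℝ) → ℝ) (x : Fin n → ℝ) {r : ℝ} (hr : 0 < r) :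
    ∫ y in eBall x r, φ y = r ^ n * ∫ u in eBall 0 1, φ (x + r • u) := by
  rw [← integral_indicator (isOpen_eBall x r).measurableSet,
    ← integral_indicator (isOpen_eBall 0 1).measurableSet,
    ← integral_add_left_eq_self _ x]
  have h : (fun u : Fin n → ℝ => (eBall 0 1).indicator (fun u => φ (x + r • u)) u) =
      fun u => (fun y => (eBall x r).indicator φ (x + y)) (r • u) := by
    funext u
    have : u ∈ eBall 0 1 ↔ x + r • u ∈ eBall x r := by
      simp only [eBall, mem_ofPred_eq, Pi.zero_apply, sub_zero, Pi.add_apply, Pi.smul_apply,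
        smul_eq_mul, add_sub_cancel_left, mul_pow, ← Finset.mul_sum, one_pow]
      exact (mul_lt_iff_lt_one_right (by positivity)).symm
    by_cases hu : u ∈ eBall 0 1
    · simp [hu, this.1 hu]
    · simp [hu, mt this.2 hu]
  rw [h, Measure.integral_comp_smul volume (fun y => (eBall x r).indicator φ (x + y))]
  have : r ^ n ≠ 0 := by positivity
  simp only [Module.finrank_fintype_fun_eq_card, Fintype.card_fin, smul_eq_mul,
    abs_of_pos (inv_pos.2 (pow_pos hr n))]
  field_simp

lemma setAverage_eBall {n : ℕ} (φ : (Fin n → ℝ) → ℝ) (x : Fin n → ℝ) {r : ℝ} (hr : 0 < r) :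
    ⨍ y in eBall x r, φ y = ⨍ u in eBall 0 1, φ (x + r • u) := by
  have h := setIntegral_eBall (fun _ => 1) x hr
  simp only [setIntegral_const, smul_eq_mul, mul_one] at h
  rw [setAverage_eq, setAverage_eq, setIntegral_eBall φ x hr, h]
  have : r ^ n ≠ 0 := by positivity
  simp only [smul_eq_mul]
  field_simp

/-- The normalized Lebesgue measure on the Euclidean unit ball. -/
def unitBallMeasure (n : ℕ) : Measure (Fin n → ℝ) :=
  (volume (eBall (0 : Fin n → ℝ) 1))⁻¹ • volume.restrict (eBall 0 1)

instance (n : ℕ) : IsProbabilityMeasure (unitBallMeasure n) :=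
  ⟨by simp [unitBallMeasure, ENNReal.inv_mul_cancel volume_eBall_ne_zero volume_eBall_ne_top]⟩

lemma ae_unitBallMeasure (n : ℕ) : ∀ᵐ u ∂unitBallMeasure n, u ∈ eBall 0 1 :=
  Measure.ae_smul_measure (ae_restrict_mem (isOpen_eBall 0 1).measurableSet) _

lemma setAverage_eBall_eq_integral {n : ℕ} (φ : (Fin n → ℝ) → ℝ) (x : Fin n → ℝ) {r : ℝ}
    (hr : 0 < r) : ⨍ y in eBall x r, φ y = ∫ u, φ (x + r • u) ∂unitBallMeasure n := by
  rw [setAverage_eBall φ x hr, average, unitBallMeasure, Measure.restrict_apply_univ]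

lemma integrable_unitBallMeasure {n : ℕ} {F : (Fin n → ℝ) → ℝ} (hF : Continuous F) :
    Integrable F (unitBallMeasure n) := by
  refine Integrable.smul_measure ?_ (ENNReal.inv_ne_top.2 volume_eBall_ne_zero)
  have := hF.continuousOn.integrableOn_compact (μ := volume)
    (isCompact_closedBall (0 : Fin n → ℝ) 1)
  exact this.mono_set fun u hu => by simpa using norm_le_one_of_mem_eBall hu

/-- The product of two normalized unit balls and the unit interval. -/
def segmentMeasure (n : ℕ) : Measure ((Fin n → ℝ) × (Fin n → ℝ) × ℝ) :=
  (unitBallMeasure n).prod ((unitBallMeasure n).prod (volume.restrict (Icc 0 1)))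

instance (n : ℕ) : IsProbabilityMeasure (segmentMeasure n) := by
  have : IsProbabilityMeasure (volume.restrict (Icc (0 : ℝ) 1)) := ⟨by simp⟩
  unfold segmentMeasure
  infer_instance

/-- The point dividing a segment in a given ratio. -/
def segmentPoint {n : ℕ} (w : (Fin n → ℝ) × (Fin n → ℝ) × ℝ) : Fin n → ℝ :=
  w.2.1 + w.2.2 • (w.1 - w.2.1)

lemma continuous_segmentPoint {n : ℕ} : Continuous (segmentPoint (n := n)) := by
  unfold segmentPoint
  fun_prop

lemma osc_le_lintegral {n : ℕ} {f : (Fin n → ℝ) → ℝ} (hf : ContDiff ℝ 1 f) (x : Fin n → ℝ)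
    {r : ℝ} (hr : 0 < r) :
    ENNReal.ofReal (osc f (eBall x r)) ≤ ENNReal.ofReal (2 * r) *
      ∫⁻ w, ‖fderiv ℝ f (x + r • segmentPoint w)‖ₑ ∂segmentMeasure n := by
  have hcont : Continuous fun y => ‖fderiv ℝ f y‖ₑ := (hf.continuous_fderiv one_ne_zero).enorm
  have hm : Measurable fun w : (Fin n → ℝ) × (Fin n → ℝ) × ℝ =>
      ‖fderiv ℝ f (x + r • segmentPoint w)‖ₑ :=
    (hcont.comp (continuous_const.add (continuous_segmentPoint.const_smul r))).measurable
  have hint : Integrable (fun u => f (x + r • u)) (unitBallMeasure n) :=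
    integrable_unitBallMeasure (hf.continuous.comp (by fun_prop))
  rw [osc, setAverage_eBall_eq_integral _ x hr, setAverage_eBall_eq_integral _ x hr,
    segmentMeasure, lintegral_prod _ hm.aemeasurable,
    ← lintegral_const_mul _ hm.lintegral_prod_right']
  refine ((ENNReal.ofReal_le_ofReal (le_abs_self _)).trans
    (Real.enorm_eq_ofReal_abs _).ge).trans ?_
  refine (enorm_integral_le_lintegral_enorm _).trans (lintegral_mono_ae ?_)
  filter_upwards [ae_unitBallMeasure n] with u hu
  have h1 : f (x + r • u) - ∫ v, f (x + r • v) ∂unitBallMeasure n =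
      ∫ v, (f (x + r • u) - f (x + r • v)) ∂unitBallMeasure n := by
    rw [integral_sub (integrable_const _) hint]
    simp
  have hmu : Measurable fun q : (Fin n → ℝ) × ℝ =>
      ‖fderiv ℝ f (x + r • segmentPoint (u, q))‖ₑ := hm.comp measurable_prodMk_left
  rw [Real.enorm_abs, h1, lintegral_prod _ hmu.aemeasurable,
    ← lintegral_const_mul _ hmu.lintegral_prod_right']
  refine (enorm_integral_le_lintegral_enorm _).trans (lintegral_mono_ae ?_)
  filter_upwards [ae_unitBallMeasure n] with v hv
  refine (enorm_sub_le_lintegral_fderiv hf _ _).trans (mul_le_mul' ?_ (le_of_eq ?_))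
  · rw [← ofReal_norm]
    refine ENNReal.ofReal_le_ofReal ?_
    rw [add_sub_add_left_eq_sub, ← smul_sub, norm_smul, Real.norm_of_nonneg hr.le]
    have := norm_sub_le u v
    have := norm_le_one_of_mem_eBall hu
    have := norm_le_one_of_mem_eBall hv
    nlinarith
  · refine lintegral_congr fun t => ?_
    congr 2
    simp only [segmentPoint]
    module

/-- The part of `g` at height above `1 / (k * r)`. -/
def highPart {α : Type*} (g : α → ℝ) (k r : ℝ) (y : α) : ℝ≥0∞ :=
  if 1 < k * r * g y then ENNReal.ofReal (g y) else 0

lemma measurable_highPart {α : Type*} [MeasurableSpace α] {g : α → ℝ} (hg : Measurable g)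
    (k : ℝ) : Measurable fun z : ℝ × α => highPart g k z.1 z.2 := by
  unfold highPart
  refine Measurable.ite (measurableSet_lt measurable_const ?_) ?_ measurable_const
  · fun_prop
  · fun_prop

lemma lintegral_highPart {α : Type*} (g : α → ℝ) (y : α) (hg : 0 ≤ g y) {k p : ℝ} (hk : 0 < k)
    (hp : 1 < p) :
    ∫⁻ r in Ioi (0 : ℝ), ENNReal.ofReal (r ^ (-(p + 1))) *
        (ENNReal.ofReal (k * r) * highPart g k r y) =
      ENNReal.ofReal (k ^ p / (p - 1)) * ENNReal.ofReal (g y ^ p) := by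
  have hp1 : 0 < p - 1 := by linarith
  rcases hg.eq_or_lt with h0 | h0
  · simp [highPart, ← h0, Real.zero_rpow (by linarith : p ≠ 0)]
  have hkg : 0 < k * g y := by positivity
  have hc : 0 < (k * g y)⁻¹ := by positivity
  have hmem : ∀ r : ℝ, (k * g y)⁻¹ < r ↔ 1 < k * r * g y := fun r => by
    rw [inv_lt_iff_one_lt_mul₀ hkg, mul_right_comm, mul_comm r]
  have h : ∀ r ∈ Ioi (0 : ℝ), ENNReal.ofReal (r ^ (-(p + 1))) *
        (ENNReal.ofReal (k * r) * highPart g k r y) =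
      (Ioi (k * g y)⁻¹).indicator (fun r => ENNReal.ofReal (k * g y * r ^ (-p))) r := by
    intro r hr
    have hr' : (0 : ℝ) < r := hr
    by_cases hrc : (k * g y)⁻¹ < r
    · rw [indicator_of_mem (mem_Ioi.2 hrc), highPart, if_pos ((hmem r).1 hrc),
        ← ENNReal.ofReal_mul (by positivity), ← ENNReal.ofReal_mul (by positivity)]
      congr 1
      have : r ^ (-p) = r ^ (-(p + 1)) * r := by
        rw [← Real.rpow_add_one hr'.ne']
        ring_nf
      rw [this]
      ring
    · rw [indicator_of_notMem (by simpa using hrc), highPart, if_neg (mt (hmem r).2 hrc)]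
      simp
  rw [setLIntegral_congr_fun measurableSet_Ioi h, setLIntegral_indicator measurableSet_Ioi,
    inter_eq_left.2 (Ioi_subset_Ioi hc.le), ← ofReal_integral_eq_lintegral_ofReal
      ((integrableOn_Ioi_rpow_of_lt (by linarith) hc).const_mul _)
      ((ae_restrict_mem measurableSet_Ioi).mono fun r hr => by
        have : (0 : ℝ) < r := hc.trans hr
        positivity),
    integral_const_mul, integral_Ioi_rpow_of_lt (by linarith) hc,
    ← ENNReal.ofReal_mul (by positivity)]
  congr 1
  have h1 : (k * g y)⁻¹ ^ (-p + 1) = (k * g y) ^ (p - 1) := by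
    rw [Real.inv_rpow hkg.le, ← Real.rpow_neg hkg.le]
    ring_nf
  have h2 : (k * g y) ^ (p - 1) * (k * g y) = k ^ p * g y ^ p := by
    rw [← Real.rpow_add_one hkg.ne', sub_add_cancel, Real.mul_rpow hk.le hg]
  have h3 : -p + 1 ≠ 0 := by linarith
  rw [h1, div_mul_eq_mul_div, ← h2]
  field_simp
  ring

lemma nuP_le_lintegral {n : ℕ} {p : ℝ} (hp : 1 < p) {g : (Fin n → ℝ) → ℝ} (hg : Measurable g)
    (hg0 : ∀ y, 0 ≤ g y) {k : ℝ} (hk : 0 < k) {Ω : Type*} [MeasurableSpace Ω] (P : Measure Ω)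
    [IsProbabilityMeasure P] {T : Ω → Fin n → ℝ} (hT : Measurable T) {S : Set ((Fin n → ℝ) × ℝ)}
    (hS : ∀ z ∈ S, 0 < z.2 ∧
      1 ≤ ENNReal.ofReal (k * z.2) * ∫⁻ w, highPart g k z.2 (z.1 + z.2 • T w) ∂P) :
    nuP n p S ≤ ENNReal.ofReal (k ^ p / (p - 1)) * ∫⁻ y, ENNReal.ofReal (g y ^ p) := by
  have hh := measurable_highPart hg k
  have hmeas : Measurable fun z : (Fin n → ℝ) × ℝ =>
      ENNReal.ofReal (k * z.2) * ∫⁻ w, highPart g k z.2 (z.1 + z.2 • T w) ∂P := by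
    refine Measurable.mul (by fun_prop) (Measurable.lintegral_prod_right'
      (f := fun q : ((Fin n → ℝ) × ℝ) × Ω => highPart g k q.1.2 (q.1.1 + q.1.2 • T q.2)) ?_)
    exact hh.comp (by fun_prop : Measurable fun q : ((Fin n → ℝ) × ℝ) × Ω =>
      (q.1.2, q.1.1 + q.1.2 • T q.2))
  have hpos : MeasurableSet {z : (Fin n → ℝ) × ℝ | 0 < z.2} :=
    measurableSet_lt measurable_const measurable_snd
  have hd : Measurable fun z : (Fin n → ℝ) × ℝ => ENNReal.ofReal (z.2 ^ (-(p + 1))) := by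
    fun_prop
  have hinner : ∀ r : ℝ, ∫⁻ x : Fin n → ℝ, ∫⁻ w, highPart g k r (x + r • T w) ∂P =
      ∫⁻ y, highPart g k r y := by
    intro r
    rw [lintegral_lintegral_swap]
    · simp [lintegral_add_right_eq_self]
    · exact (hh.comp (by fun_prop : Measurable fun q : (Fin n → ℝ) × Ω =>
        (r, q.1 + r • T q.2))).aemeasurable
  calc nuP n p S
      ≤ ∫⁻ z, {z : (Fin n → ℝ) × ℝ | 0 < z.2}.indicator (fun z => ENNReal.ofReal (k * z.2) *
          ∫⁻ w, highPart g k z.2 (z.1 + z.2 • T w) ∂P) z ∂nuP n p := by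
        refine meas_le_lintegral₀ (hmeas.indicator hpos).aemeasurable fun z hz => ?_
        rw [indicator_of_mem (show z ∈ {z : (Fin n → ℝ) × ℝ | 0 < z.2} from (hS z hz).1)]
        exact (hS z hz).2
    _ = ∫⁻ r in Ioi (0 : ℝ), ∫⁻ x : Fin n → ℝ, ENNReal.ofReal (r ^ (-(p + 1))) *
          (ENNReal.ofReal (k * r) * ∫⁻ w, highPart g k r (x + r • T w) ∂P) := by
        rw [nuP, lintegral_withDensity_eq_lintegral_mul _ hd (hmeas.indicator hpos),
          lintegral_prod_symm' _ (hd.mul (hmeas.indicator hpos)),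
          ← lintegral_indicator measurableSet_Ioi]
        refine lintegral_congr fun r => ?_
        by_cases hr : 0 < r
        · simp [indicator, hr]
        · simp [indicator, hr]
    _ = ∫⁻ r in Ioi (0 : ℝ), ∫⁻ y, ENNReal.ofReal (r ^ (-(p + 1))) *
          (ENNReal.ofReal (k * r) * highPart g k r y) := by
        refine lintegral_congr fun r => ?_
        have h1 : Measurable fun y => highPart g k r y := hh.comp measurable_prodMk_left
        simp only [lintegral_const_mul' _ _ ENNReal.ofReal_ne_top, hinner]
    _ = ∫⁻ y, ∫⁻ r in Ioi (0 : ℝ), ENNReal.ofReal (r ^ (-(p + 1))) *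
          (ENNReal.ofReal (k * r) * highPart g k r y) := by
        refine lintegral_lintegral_swap (Measurable.aemeasurable ?_)
        exact Measurable.mul (by fun_prop) (Measurable.mul (by fun_prop) hh)
    _ = ENNReal.ofReal (k ^ p / (p - 1)) * ∫⁻ y, ENNReal.ofReal (g y ^ p) := by
        rw [← lintegral_const_mul' _ _ ENNReal.ofReal_ne_top]
        exact lintegral_congr fun y => lintegral_highPart g y (hg0 y) hk hp

lemma one_le_lintegral_highPart {Ω : Type*} [MeasurableSpace Ω] (P : Measure Ω)
    [IsProbabilityMeasure P] (G : Ω → ℝ) {l r : ℝ} (hl : 0 < l) (hr : 0 < r)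
    (h : ENNReal.ofReal l ≤ ENNReal.ofReal (2 * r) * ∫⁻ w, ENNReal.ofReal (G w) ∂P) :
    1 ≤ ENNReal.ofReal (4 / l * r) * ∫⁻ w, highPart G (4 / l) r w ∂P := by
  have h1 : ∫⁻ w, ENNReal.ofReal (G w) ∂P ≤
      ENNReal.ofReal (l / (4 * r)) + ∫⁻ w, highPart G (4 / l) r w ∂P := by
    have : ENNReal.ofReal (l / (4 * r)) = ∫⁻ _, ENNReal.ofReal (l / (4 * r)) ∂P := by simp
    rw [this, ← lintegral_add_left measurable_const]
    refine lintegral_mono fun w => ?_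
    simp only [highPart]
    split_ifs with hw
    · exact le_add_self
    · rw [add_zero]
      refine ENNReal.ofReal_le_ofReal ?_
      rw [not_lt] at hw
      rw [le_div_iff₀ (by positivity)]
      have := mul_le_mul_of_nonneg_left hw hl.le
      field_simp at this
      linarith
  generalize ∫⁻ w, highPart G (4 / l) r w ∂P = A at *
  have h2 := h.trans (mul_le_mul_right h1 _)
  rw [mul_add, ← ENNReal.ofReal_mul (by positivity)] at h2
  have e1 : 2 * r * (l / (4 * r)) = l / 2 := by field_simp; norm_num
  have e2 : ENNReal.ofReal l = ENNReal.ofReal (l / 2) + ENNReal.ofReal (l / 2) := by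
    rw [← ENNReal.ofReal_add (by positivity) (by positivity), add_halves]
  rw [e1, e2] at h2
  have h3 := (ENNReal.add_le_add_iff_left ENNReal.ofReal_ne_top).1 h2
  have h4 := mul_le_mul_right h3 (ENNReal.ofReal (2 / l))
  rw [← mul_assoc, ← ENNReal.ofReal_mul (by positivity), ← ENNReal.ofReal_mul (by positivity)]
    at h4
  have e3 : 2 / l * (l / 2) = 1 := by field_simp
  have e4 : 2 / l * (2 * r) = 4 / l * r := by ring
  rwa [e3, e4, ENNReal.ofReal_one] at h4

/-- for `1 < p < ∞` and a continuously differentiable `f : ℝⁿ → ℝ` with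
`∫ |∇f|^p < ∞`, with `m(f)(x,r) = O(f,B(x,r))`, one has
`sup_{λ>0} λ^p ν_p({m(f) > λ}) ≤ C ∫ |∇f|^p`, i.e.
`‖m(f)‖_{L^{p,∞}(ℝ^{n+1}_+, ν_p)} ≲ ‖∇f‖_{L^p(ℝⁿ)}`. -/
theorem statement18 (n : ℕ) (p : ℝ) (hp : 1 < p) :
    ∃ C : ℝ, 0 < C ∧
      ∀ f : (Fin n → ℝ) → ℝ, ContDiff ℝ 1 f →
      (∫⁻ x, ENNReal.ofReal (‖fderiv ℝ f x‖ ^ p)) < ∞ →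
      (⨆ l ∈ Set.Ioi (0 : ℝ), ENNReal.ofReal (l ^ p) *
          nuP n p {z : (Fin n → ℝ) × ℝ | 0 < z.2 ∧ l < osc f (eBall z.1 z.2)})
        ≤ ENNReal.ofReal C * ∫⁻ x, ENNReal.ofReal (‖fderiv ℝ f x‖ ^ p) := by
  have hp1 : 0 < p - 1 := by linarith
  refine ⟨4 ^ p / (p - 1), by positivity, fun f hf _ => iSup₂_le fun l hl => ?_⟩
  have hl0 : 0 < l := hl
  have key := nuP_le_lintegral hp (g := fun y => ‖fderiv ℝ f y‖)
    (hf.continuous_fderiv one_ne_zero).norm.measurable (fun _ => norm_nonneg _)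
    (k := 4 / l) (by positivity) (segmentMeasure n) continuous_segmentPoint.measurable
    (S := {z : (Fin n → ℝ) × ℝ | 0 < z.2 ∧ l < osc f (eBall z.1 z.2)}) fun z hz => ⟨hz.1, ?_⟩
  · refine (mul_le_mul_right key _).trans (le_of_eq ?_)
    rw [← mul_assoc, ← ENNReal.ofReal_mul (by positivity), Real.div_rpow (by norm_num) hl0.le]
    congr 2
    have : l ^ p ≠ 0 := (Real.rpow_pos_of_pos hl0 p).ne'
    field_simp
  · refine one_le_lintegral_highPart (segmentMeasure n)
      (fun w => ‖fderiv ℝ f (z.1 + z.2 • segmentPoint w)‖) hl0 hz.1 ?_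
    simp only [ofReal_norm]
    exact (ENNReal.ofReal_le_ofReal hz.2.le).trans (osc_le_lintegral hf z.1 hz.1)
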